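/- Define the wave-curve maps T₁(σ)(w,v) = (w + σ, v − W(σ)) and T₂(σ)(w,v) = (w − σ, v − W(σ)) on ℝ². For any two states (w_l, v_l) and (w_r, v_r) in ℝ² there exists a unique pair (σ₁, σ₂) ∈ ℝ × ℝ such that (w_r, v_r) = T₂(σ₂)(T₁(σ₁)(w_l, v_l)). -/

import Mathlib

/-- `W(s) = s` for `s ≤ 0` and `W(s) = 2 sinh(s/2)` for `s ≥ 0`. -/
noncomputable def W (s : ℝ) : ℝ := if s ≤ 0 then s else 2 * Real.sinh (s / 2)

/-- The `1`-wave curve map: `T₁(σ)(w,v) = (w + σ, v - W(σ))`. -/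
noncomputable def T1 (σ : ℝ) (u : ℝ × ℝ) : ℝ × ℝ := (u.1 + σ, u.2 - W σ)

/-- The `2`-wave curve map: `T₂(σ)(w,v) = (w - σ, v - W(σ))`. -/
noncomputable def T2 (σ : ℝ) (u : ℝ × ℝ) : ℝ × ℝ := (u.1 - σ, u.2 - W σ)

theorem W_eq_max (s : ℝ) : W s = max s (2 * Real.sinh (s / 2)) := by
  unfold W
  split_ifs with h
  · have := Real.sinh_le_self_iff.2 (show s / 2 ≤ 0 by linarith)
    rw [max_eq_left (by linarith)]
  · have := Real.self_le_sinh_iff.2 (show 0 ≤ s / 2 by linarith)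
    rw [max_eq_right (by linarith)]

theorem continuous_W : Continuous W := by
  simp only [funext W_eq_max]
  fun_prop

theorem strictMono_W : StrictMono W := fun a b hab => by
  have := Real.sinh_lt_sinh.2 (show a / 2 < b / 2 by linarith)
  rw [W_eq_max, W_eq_max]
  exact max_lt_max hab (by linarith)

open Filter in
theorem tendsto_W_atTop : Tendsto W atTop atTop :=
  tendsto_atTop_mono (fun s => (W_eq_max s).symm ▸ le_max_left _ _) tendsto_id

open Filter in
theorem tendsto_W_atBot : Tendsto W atBot atBot :=
  tendsto_id.congr' <| (eventually_le_atBot 0).mono fun _ hs => (if_pos hs).symm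

open Filter in
theorem bijective_W_add_W_sub (d : ℝ) : Function.Bijective fun s => W s + W (s - d) := by
  refine ⟨(strictMono_W.add fun a b hab => strictMono_W (by linarith)).injective, ?_⟩
  refine (continuous_W.add (continuous_W.comp (by fun_prop))).surjective ?_ ?_
  · exact tendsto_W_atTop.atTop_add_atTop
      (tendsto_W_atTop.comp (tendsto_atTop_add_const_right _ (-d) tendsto_id))
  · exact tendsto_W_atBot.atBot_add_atBot
      (tendsto_W_atBot.comp (tendsto_atBot_add_const_right _ (-d) tendsto_id))

/-- Any two states are connected by a unique pair of wave strengths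
`(σ₁, σ₂)`: the Riemann problem for the isothermal p-system is uniquely solvable. -/
theorem exists_unique_riemann_solution (wl vl wr vr : ℝ) :
    ∃! σ : ℝ × ℝ, (wr, vr) = T2 σ.2 (T1 σ.1 (wl, vl)) := by
  obtain ⟨s, hs, huniq⟩ := (bijective_W_add_W_sub (wr - wl)).existsUnique (vl - vr)
  simp only at hs huniq
  refine ⟨(s, s - (wr - wl)), ?_, ?_⟩
  · simp only [T1, T2, Prod.mk.injEq]
    constructor <;> linarith
  · rintro ⟨a, b⟩ hab
    simp only [T1, T2, Prod.mk.injEq] at hab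
    obtain ⟨h1, h2⟩ := hab
    obtain rfl : b = a - (wr - wl) := by linarith
    rw [huniq a (by linarith)]
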